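/- arXiv:1401.3325 — 2 statements merged into one kernel-verified Lean document; each statement's English description precedes it below -/
import Mathlib

section
/- Let A be a nonempty countable set of players, C a nonempty finite set of choices, d : C* → A, and for each a ∈ A let f_a : C^ω → [0,1] be continuous, where C^ω carries the product topology induced by the discrete topology on C. Then the infinite sequential game ⟨A, C, d, (f_a)_{a∈A}⟩ has a subgame perfect equilibrium: a strategy profile σ such that for every γ ∈ C*, every player a, and every a-deviation σ' of σ, f_a(p^γ(σ')) ≤ f_a(p^γ(σ)). -/
namespace SeqGame

variable {A C O : Type*}

/-- The length-`n` prefix of an infinite sequence, as a list. -/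
def pre (p : ℕ → C) (n : ℕ) : List C := List.ofFn (fun i : Fin n => p i)

/-- The length-`n` history of the play induced by the strategy profile `σ` starting at `γ`. -/
def hist (σ : List C → C) (γ : List C) : ℕ → List C
  | 0 => []
  | n + 1 => hist σ γ n ++
      [if h : n < γ.length then γ.get ⟨n, h⟩ else σ (hist σ γ n)]

/-- The play `p^γ(σ)` induced by the strategy profile `σ` starting at `γ`. -/
def play (σ : List C → C) (γ : List C) (n : ℕ) : C :=
  if h : n < γ.length then γ.get ⟨n, h⟩ else σ (hist σ γ n)

/-- `σ'` is an `a`-deviation of the strategy profile `σ`. -/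
def Dev (d : List C → A) (a : A) (σ σ' : List C → C) : Prop :=
  ∀ h : List C, d h ≠ a → σ' h = σ h

end SeqGame

namespace SeqGame

theorem hist_succ {C : Type*} (σ : List C → C) (γ : List C) (n : ℕ) :
    hist σ γ (n + 1) = hist σ γ n ++ [play σ γ n] := rfl

theorem play_of_lt {C : Type*} (σ : List C → C) {γ : List C} {n : ℕ} (h : n < γ.length) :
    play σ γ n = γ[n] := by
  simp [play, h]

theorem play_of_le {C : Type*} (σ : List C → C) {γ : List C} {n : ℕ} (h : γ.length ≤ n) :
    play σ γ n = σ (hist σ γ n) := by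
  simp [play, h]

theorem length_hist {C : Type*} (σ : List C → C) (γ : List C) (n : ℕ) :
    (hist σ γ n).length = n := by
  induction n with
  | zero => rfl
  | succ n ih => simp [hist_succ, ih]

/-- Up to the length of the starting position, the history is a prefix of that position. -/
theorem hist_eq_take {C : Type*} (σ : List C → C) (γ : List C) {n : ℕ} (hn : n ≤ γ.length) :
    hist σ γ n = γ.take n := by
  induction n with
  | zero => simp [hist]
  | succ n ih => rw [hist_succ, ih (by omega), play_of_lt σ hn, List.take_append_getElem]

/-- The play from `γ` depends only on the choices at positions at least as long as `γ`. -/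
theorem play_congr {C : Type*} {σ τ : List C → C} {γ : List C}
    (h : ∀ η : List C, γ.length ≤ η.length → σ η = τ η) : play σ γ = play τ γ := by
  have step : ∀ n, hist σ γ n = hist τ γ n → play σ γ n = play τ γ n := by
    intro n hn
    rcases lt_or_ge n γ.length with hlt | hge
    · rw [play_of_lt σ hlt, play_of_lt τ hlt]
    · rw [play_of_le σ hge, play_of_le τ hge, ← hn]
      exact h _ (by rwa [length_hist])
  have hist_eq : ∀ n, hist σ γ n = hist τ γ n := by
    intro n
    induction n with
    | zero => rfl
    | succ n ih => rw [hist_succ, hist_succ, step n ih, ih]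
  exact funext fun n => step n (hist_eq n)

/-- Making the move prescribed at `γ` does not change the induced play. -/
theorem play_append_self {C : Type*} (σ : List C → C) (γ : List C) :
    play σ (γ ++ [σ γ]) = play σ γ := by
  have step : ∀ n, hist σ (γ ++ [σ γ]) n = hist σ γ n →
      play σ (γ ++ [σ γ]) n = play σ γ n := by
    intro n hn
    rcases lt_trichotomy n γ.length with hlt | rfl | hgt
    · rw [play_of_lt σ hlt, play_of_lt σ (by simp; omega), List.getElem_append_left hlt]
    · rw [play_of_le σ le_rfl, play_of_lt σ (by simp), hist_eq_take σ γ le_rfl]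
      simp
    · rw [play_of_le σ hgt.le, play_of_le σ (by simp; omega), hn]
  have hist_eq : ∀ n, hist σ (γ ++ [σ γ]) n = hist σ γ n := by
    intro n
    induction n with
    | zero => rfl
    | succ n ih => rw [hist_succ, hist_succ, step n ih, ih]
  exact funext fun n => step n (hist_eq n)

/-- The play is continuous in the strategy profile, for pointwise eventual equality. -/
theorem eventually_play_eq {C ι : Type*} {l : Filter ι} {s : ι → List C → C} {σ : List C → C}
    (h : ∀ η : List C, ∀ᶠ i in l, s i η = σ η) (γ : List C) (n : ℕ) :
    ∀ᶠ i in l, play (s i) γ n = play σ γ n := by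
  have step : ∀ n, (∀ᶠ i in l, hist (s i) γ n = hist σ γ n) →
      ∀ᶠ i in l, play (s i) γ n = play σ γ n := by
    intro n hn
    rcases lt_or_ge n γ.length with hlt | hge
    · exact Filter.Eventually.of_forall fun i => by rw [play_of_lt _ hlt, play_of_lt _ hlt]
    · filter_upwards [hn, h (hist σ γ n)] with i hi hi'
      rw [play_of_le _ hge, play_of_le _ hge, hi, hi']
  have hist_eq : ∀ n, ∀ᶠ i in l, hist (s i) γ n = hist σ γ n := by
    intro n
    induction n with
    | zero => exact Filter.Eventually.of_forall fun i => rfl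
    | succ n ih =>
      filter_upwards [ih, step n ih] with i hi hi'
      rw [hist_succ, hist_succ, hi, hi']
  exact step n (hist_eq n)

theorem tendsto_play {C ι : Type*} [TopologicalSpace C] {l : Filter ι}
    {s : ι → List C → C} {σ : List C → C}
    (h : ∀ η : List C, ∀ᶠ i in l, s i η = σ η) (γ : List C) :
    Filter.Tendsto (fun i => play (s i) γ) l (nhds (play σ γ)) :=
  tendsto_pi_nhds.2 fun n => tendsto_nhds_of_eventually_eq (eventually_play_eq h γ n)

/-- Backward induction: some profile admits no profitable deviation that changes choices only
at positions of length less than `n`, starting from any position of length at least `m`. -/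
theorem exists_equilibrium_of_length_ge {A C : Type*} [Nonempty C] [Finite C]
    (d : List C → A) (f : A → (ℕ → C) → ℝ) {m n : ℕ} (hmn : m ≤ n) :
    ∃ τ : List C → C, ∀ γ : List C, m ≤ γ.length → ∀ (a : A) (τ' : List C → C),
      Dev d a τ τ' → (∀ η : List C, n ≤ η.length → τ' η = τ η) →
        f a (play τ' γ) ≤ f a (play τ γ) := by
  classical
  induction hmn using Nat.decreasingInduction with
  | self =>
    refine ⟨fun _ => Classical.arbitrary C, fun γ hγ a τ' _ hτ' => ?_⟩
    rw [play_congr fun η hη => hτ' η (hγ.trans hη)]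
  | of_succ m hm ih =>
    obtain ⟨τ, hτ⟩ := ih
    choose best h_best using fun γ : List C =>
      Finite.exists_max fun c => f (d γ) (play τ (γ ++ [c]))
    let ρ : List C → C := fun η => if η.length = m then best η else τ η
    have hρ : ∀ γ : List C, m + 1 ≤ γ.length → play ρ γ = play τ γ := fun γ hγ =>
      play_congr fun η hη => if_neg (by omega)
    have later : ∀ γ : List C, m + 1 ≤ γ.length → ∀ (a : A) (τ' : List C → C),
        Dev d a ρ τ' → (∀ η : List C, n ≤ η.length → τ' η = ρ η) →
          f a (play τ' γ) ≤ f a (play τ γ) := by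
      intro γ hγ a τ' hdev hlong
      have h_eq : play τ' γ = play (fun η => if η.length = m then τ η else τ' η) γ :=
        play_congr fun η hη => (if_neg (by omega)).symm
      rw [h_eq]
      refine hτ γ hγ a _ (fun η hη => ?_) fun η hη => ?_
      · have := hdev η hη
        by_cases hl : η.length = m <;> simp_all [ρ]
      · have := hlong η hη
        by_cases hl : η.length = m <;> simp_all [ρ]
    refine ⟨ρ, fun γ hγ a τ' hdev hlong => ?_⟩
    rcases hγ.lt_or_eq with hlt | heq
    · rw [hρ γ hlt]
      exact later γ hlt a τ' hdev hlong
    · have hlen : ∀ c, m + 1 ≤ (γ ++ [c]).length := fun c => by simp [heq]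
      rw [← play_append_self τ' γ, ← play_append_self ρ γ, hρ _ (hlen _)]
      refine (later _ (hlen _) a τ' hdev hlong).trans ?_
      by_cases hd : d γ = a
      · have hb : ρ γ = best γ := if_pos heq.symm
        rw [hb, ← hd]
        exact h_best γ _
      · rw [hdev γ hd]

end SeqGame

open SeqGame in
/-- an infinite sequential game with countably many players, finitely many
choices and continuous payoff functions has a subgame perfect equilibrium. -/
theorem stmt3 {A C : Type*} [Nonempty A] [Countable A] [Nonempty C] [Finite C]
    [TopologicalSpace C] [DiscreteTopology C]
    (d : List C → A) (f : A → (ℕ → C) → ℝ)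
    (hf01 : ∀ (a : A) (p : ℕ → C), f a p ∈ Set.Icc (0 : ℝ) 1)
    (hcont : ∀ a : A, Continuous (f a)) :
    ∃ σ : List C → C, ∀ (γ : List C) (a : A) (σ' : List C → C),
      Dev d a σ σ' → f a (play σ' γ) ≤ f a (play σ γ) := by
  classical
  choose s hs using fun n => exists_equilibrium_of_length_ge d f (Nat.zero_le n)
  have hlim : ∀ η : List C, ∃ c, ∀ᶠ n in (Filter.hyperfilter ℕ : Filter ℕ), s n η = c := by
    intro η
    obtain ⟨c, hc⟩ := ((Filter.hyperfilter ℕ).map fun n => s n η).eq_pure_of_finite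
    refine ⟨c, ?_⟩
    have hmem : {c} ∈ (Filter.hyperfilter ℕ).map fun n => s n η := by
      rw [hc]
      exact Ultrafilter.mem_pure.2 rfl
    exact hmem
  choose σ hσ using hlim
  refine ⟨σ, fun γ a σ' hdev => ?_⟩
  let s' : ℕ → List C → C := fun n η => if η.length < n ∧ d η = a then σ' η else s n η
  have hs' : ∀ η : List C, ∀ᶠ n in (Filter.hyperfilter ℕ : Filter ℕ), s' n η = σ' η := by
    intro η
    by_cases hd : d η = a
    · have hgt : ∀ᶠ n in (Filter.hyperfilter ℕ : Filter ℕ), η.length < n :=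
        Nat.hyperfilter_le_atTop (Filter.eventually_gt_atTop η.length)
      filter_upwards [hgt] with n hn
      exact if_pos ⟨hn, hd⟩
    · filter_upwards [hσ η] with n hn
      rw [hdev η hd, ← hn]
      exact if_neg fun h => hd h.2
  refine le_of_tendsto_of_tendsto (((hcont a).tendsto _).comp (tendsto_play hs' γ))
    (((hcont a).tendsto _).comp (tendsto_play hσ γ)) (Filter.Eventually.of_forall fun n => ?_)
  exact hs n γ (Nat.zero_le _) a (s' n) (fun η hη => if_neg fun h => hη h.2)
    fun η hη => if_neg fun h => by omega
end

section
/- Let ⟨A, C, d, O, v, (≺_a)_{a∈A}⟩ be an infinite sequential game, let a ∈ A, and assume: (1) ≺_a is a strict weak order; (2) for every play p ∈ C^ω and every strictly increasing φ : ℕ → ℕ, if d(p_{<φ(n)}) = a and G_a(p_{<φ(n+1)}) ⊊ G_a(p_{<φ(n)}) for all n ∈ ℕ, then v(p) ∈ ∩_{n∈ℕ} G_a(p_{<φ(n)}); (3) for every γ ∈ C* there exists a strategy s of a with g_a(γ,s) = G_a(γ). Then there exists a single strategy s of a such that g_a(γ,s) = G_a(γ) for all γ ∈ C*. -/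
namespace SeqGame

variable {A C O : Type*}

/-- `r` is a strict weak order: irreflexive, transitive, with transitive incomparability. -/
def SWO (r : O → O → Prop) : Prop :=
  (∀ x, ¬ r x x) ∧ (∀ x y z, r x y → r y z → r x z) ∧
  (∀ x y z, ¬ r x y → ¬ r y z → ¬ r x z)

/-- `r` is a strict linear order: irreflexive, transitive and total. -/
def SLO (r : O → O → Prop) : Prop :=
  (∀ x, ¬ r x x) ∧ (∀ x y z, r x y → r y z → r x z) ∧
  (∀ x y, x = y ∨ r x y ∨ r y x)

/-- The play `p` is consistent with the strategy `s` of player `a` from `γ` on. -/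
def Consistent (d : List C → A) (a : A) (s : List C → C) (γ : List C) (p : ℕ → C) : Prop :=
  pre p γ.length = γ ∧ ∀ n, γ.length ≤ n → d (pre p n) = a → p n = s (pre p n)

/-- The guarantee `g_a(γ, s)` of player `a` (with preference `r`) by strategy `s` at `γ`. -/
def gua (d : List C → A) (v : (ℕ → C) → O) (r : O → O → Prop) (a : A)
    (γ : List C) (s : List C → C) : Set O :=
  {o | ∃ p : ℕ → C, Consistent d a s γ p ∧ ¬ r o (v p)}

/-- The best guarantee `G_a(γ)` of player `a` (with preference `r`) at `γ`. -/
def Gua (d : List C → A) (v : (ℕ → C) → O) (r : O → O → Prop) (a : A) (γ : List C) : Set O :=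
  ⋂ s : List C → C, gua d v r a γ s

/-- `I` is a `r`-terminal interval: `o ∈ I` and `¬(o' ≺ o)` imply `o' ∈ I`. -/
def Terminal (r : O → O → Prop) (I : Set O) : Prop :=
  ∀ o ∈ I, ∀ o', ¬ r o' o → o' ∈ I

/-- `I` is a `r`-extremal interval. -/
def Extremal (r : O → O → Prop) (I : Set O) : Prop :=
  Terminal r I ∨ Terminal (fun x y => r y x) I

/-- `γ C^ω`: the set of plays extending the finite sequence `γ`. -/
def ext (γ : List C) : Set (ℕ → C) := {p | pre p γ.length = γ}

/-- Concatenation `γ·α` of a finite sequence and an infinite one. -/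
def cat (γ : List C) (α : ℕ → C) : ℕ → C :=
  fun n => if h : n < γ.length then γ.get ⟨n, h⟩ else α (n - γ.length)

/-- The two-player win/lose game `⟨C, D, W⟩` is determined. -/
def Determined (D : Set (List C)) (W : Set (ℕ → C)) : Prop :=
  (∃ s : List C → C, ∀ p : ℕ → C, (∀ n, pre p n ∈ D → p n = s (pre p n)) → p ∈ W) ∨
  (∃ t : List C → C, ∀ p : ℕ → C, (∀ n, pre p n ∉ D → p n = t (pre p n)) → p ∉ W)

/-- In a two-player game (`true` is player `a`, `false` is player `b`) with antagonistic
preferences, the preference of each player derived from the preference `r` of player `a`. -/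
def rel (r : O → O → Prop) : Bool → O → O → Prop
  | true => r
  | false => fun o o' => r o' o

end SeqGame


namespace SeqGame

variable {A C O : Type*}

theorem pre_succ (p : ℕ → C) (n : ℕ) : pre p (n + 1) = pre p n ++ [p n] := by
  simp only [pre, List.ofFn_succ_last, Fin.val_castSucc, Fin.val_last]

@[simp]
theorem length_pre (p : ℕ → C) (n : ℕ) : (pre p n).length = n := by
  simp [pre]

/-- A best guarantee is contained in every guarantee. -/
theorem Gua_subset_gua (d : List C → A) (v : (ℕ → C) → O) (r : O → O → Prop) (a : A)
    (γ : List C) (s : List C → C) : Gua d v r a γ ⊆ gua d v r a γ s :=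
  Set.iInter_subset _ s

/-- Extending a position by a move that agrees with `s` shrinks the guarantee of `s`. -/
theorem gua_concat_subset {d : List C → A} (v : (ℕ → C) → O) (r : O → O → Prop) {a : A}
    {γ : List C} {s : List C → C} {c : C} (hc : d γ = a → c = s γ) :
    gua d v r a (γ ++ [c]) s ⊆ gua d v r a γ s := by
  rintro o ⟨p, ⟨hp, hs⟩, ho⟩
  have hlen : (γ ++ [c]).length = γ.length + 1 := by simp
  rw [hlen, pre_succ] at hp
  obtain ⟨hγ, hpc⟩ := List.append_inj' hp rfl
  refine ⟨p, ⟨hγ, fun n hn hd => ?_⟩, ho⟩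
  rcases hn.eq_or_lt with rfl | hlt
  · rw [hγ] at hd ⊢
    rw [← hc hd]
    simpa using hpc
  · exact hs n (by omega) hd

/-- The guarantee of a strategy contains the value of every consistent play. -/
theorem mem_gua {d : List C → A} {v : (ℕ → C) → O} {r : O → O → Prop} {a : A}
    (hirr : ∀ x, ¬ r x x) {s : List C → C} {p : ℕ → C} {m : ℕ}
    (hs : ∀ n, m ≤ n → d (pre p n) = a → p n = s (pre p n)) :
    v p ∈ gua d v r a (pre p m) s :=
  ⟨p, ⟨by simp, fun n hn => hs n (by simpa using hn)⟩, hirr _⟩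

/-- Choice of an optimal strategy at each position, changed along a play only when the previously
chosen strategy stops being optimal. -/
theorem exists_lazy_optimal {d : List C → A} {v : (ℕ → C) → O} {r : O → O → Prop} {a : A}
    (h : ∀ γ : List C, ∃ s : List C → C, gua d v r a γ s = Gua d v r a γ) :
    ∃ τ : List C → List C → C, (∀ γ, gua d v r a γ (τ γ) = Gua d v r a γ) ∧
      ∀ γ c, gua d v r a (γ ++ [c]) (τ γ) = Gua d v r a (γ ++ [c]) → τ (γ ++ [c]) = τ γ := by
  classical
  choose S hS using h
  let τ : List C → List C → C := fun γ => List.reverseRecOn γ (S [])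
    (fun l c t => if gua d v r a (l ++ [c]) t = Gua d v r a (l ++ [c]) then t else S (l ++ [c]))
  have hτ : ∀ γ c, τ (γ ++ [c]) =
      if gua d v r a (γ ++ [c]) (τ γ) = Gua d v r a (γ ++ [c]) then τ γ else S (γ ++ [c]) :=
    fun γ c => List.reverseRecOn_concat ..
  refine ⟨τ, fun γ => ?_, fun γ c hc => by rw [hτ, if_pos hc]⟩
  rcases List.eq_nil_or_concat γ with rfl | ⟨l, c, rfl⟩
  · simpa [τ] using hS []
  · rw [List.concat_eq_append, hτ]
    split_ifs with hc
    · exact hc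
    · exact hS _

/-- A sequence of sets that is antitone from `m` on and never becomes constant is strictly
decreasing along a subsequence of positions where a frequently true predicate holds. -/
theorem exists_strictly_decreasing_subsequence {α : Type*} {F : ℕ → Set α} {P : ℕ → Prop} {m : ℕ}
    (hF : ∀ i j, m ≤ i → i ≤ j → F j ⊆ F i) (hP : ∀ k, ∃ n, k ≤ n ∧ P n)
    (hne : ∀ k, m ≤ k → ∃ n, k ≤ n ∧ F n ≠ F k) :
    ∃ φ : ℕ → ℕ, StrictMono φ ∧ m ≤ φ 0 ∧ (∀ n, P (φ n)) ∧ ∀ n, F (φ (n + 1)) ⊂ F (φ n) := by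
  have step : ∀ k : {k // m ≤ k ∧ P k}, ∃ l : {k // m ≤ k ∧ P k}, k.1 < l.1 ∧ F l ⊂ F k := by
    rintro ⟨k, hk, -⟩
    obtain ⟨n, hkn, hn⟩ := hne k hk
    obtain ⟨l, hnl, hl⟩ := hP n
    have hss : F l ⊂ F k := (hF n l (hk.trans hkn) hnl).trans_ssubset
      ((hF k n hk hkn).ssubset_of_ne hn)
    refine ⟨⟨l, by omega, hl⟩, (hkn.trans hnl).lt_of_ne ?_, hss⟩
    rintro rfl
    exact hss.ne rfl
  choose f hf using step
  obtain ⟨k, hk, hPk⟩ := hP m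
  let φ : ℕ → {k // m ≤ k ∧ P k} := fun n => f^[n] ⟨k, hk, hPk⟩
  have hφ : ∀ n, φ (n + 1) = f (φ n) := fun n => Function.iterate_succ_apply' ..
  refine ⟨fun n => φ n, strictMono_nat_of_lt_succ fun n => ?_, (φ 0).2.1, fun n => (φ n).2.2,
    fun n => ?_⟩
  · rw [hφ]; exact (hf _).1
  · beta_reduce; rw [hφ]; exact (hf _).2

end SeqGame

open SeqGame in
/-- if the best guarantee of player `a` is witnessed at every position, and
strictly decreasing chains of best guarantees along a play capture the outcome of that
play, then a single strategy of `a` witnesses the best guarantee at every position. -/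
theorem stmt7 {A C O : Type*} [Nonempty A] [Nonempty C] [Nonempty O]
    (d : List C → A) (v : (ℕ → C) → O) (r : O → O → Prop) (a : A)
    (hswo : SWO r)
    (h2 : ∀ (p : ℕ → C) (φ : ℕ → ℕ), StrictMono φ →
      (∀ n, d (pre p (φ n)) = a) →
      (∀ n, Gua d v r a (pre p (φ (n + 1))) ⊂ Gua d v r a (pre p (φ n))) →
      v p ∈ ⋂ n, Gua d v r a (pre p (φ n)))
    (h3 : ∀ γ : List C, ∃ s : List C → C, gua d v r a γ s = Gua d v r a γ) :
    ∃ s : List C → C, ∀ γ : List C, gua d v r a γ s = Gua d v r a γ := by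
  obtain ⟨hirr, -, hneg⟩ := hswo
  obtain ⟨τ, hopt, hlazy⟩ := exists_lazy_optimal h3
  refine ⟨fun γ => τ γ γ, fun γ => (Gua_subset_gua ..).antisymm' ?_⟩
  rintro o ⟨p, ⟨hpγ, hcons⟩, ho⟩
  suffices hv : v p ∈ Gua d v r a γ by
    refine Set.mem_iInter.2 fun s => ?_
    obtain ⟨q, hq, hvq⟩ := Set.mem_iInter.1 hv s
    exact ⟨q, hq, hneg _ _ _ ho hvq⟩
  set m := γ.length
  have hsub : ∀ n, m ≤ n → gua d v r a (pre p (n + 1)) (τ (pre p n)) ⊆ Gua d v r a (pre p n) := by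
    intro n hn
    rw [pre_succ, ← hopt (pre p n)]
    exact gua_concat_subset v r (hcons n hn)
  have hanti : ∀ i j, m ≤ i → i ≤ j → Gua d v r a (pre p j) ⊆ Gua d v r a (pre p i) := by
    intro i j hi hij
    induction j, hij using Nat.le_induction with
    | base => exact subset_rfl
    | succ j hij ih =>
      exact ((Gua_subset_gua ..).trans (hsub j (hi.trans hij))).trans ih
  suffices hv : ∃ k, m ≤ k ∧ v p ∈ Gua d v r a (pre p k) by
    obtain ⟨k, hk, hvk⟩ := hv
    exact hpγ ▸ hanti m k le_rfl hk hvk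
  by_cases hfreq : ∀ k, ∃ n, k ≤ n ∧ d (pre p n) = a
  · by_cases hne : ∀ k, m ≤ k → ∃ n, k ≤ n ∧ Gua d v r a (pre p n) ≠ Gua d v r a (pre p k)
    · obtain ⟨φ, hmono, h0, hd, hss⟩ := exists_strictly_decreasing_subsequence hanti hfreq hne
      exact ⟨φ 0, h0, Set.mem_iInter.1 (h2 p φ hmono hd hss) 0⟩
    · push Not at hne
      obtain ⟨k, hk, hconst⟩ := hne
      have hτ : ∀ n, k ≤ n → τ (pre p n) = τ (pre p k) := by
        intro n hn
        induction n, hn using Nat.le_induction with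
        | base => rfl
        | succ n hn ih =>
          rw [← ih, pre_succ]
          apply hlazy
          rw [← pre_succ]
          refine ((hsub n (hk.trans hn)).trans_eq ?_).antisymm (Gua_subset_gua ..)
          rw [hconst n hn, hconst (n + 1) (by omega)]
      refine ⟨k, hk, ?_⟩
      rw [← hopt (pre p k)]
      refine mem_gua hirr fun n hn hd => ?_
      rw [← hτ n hn]
      exact hcons n (hk.trans hn) hd
  · push Not at hfreq
    obtain ⟨k, hk⟩ := hfreq
    refine ⟨max m k, le_max_left .., Set.mem_iInter.2 fun s => mem_gua hirr fun n hn hd => ?_⟩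
    exact absurd hd (hk n ((le_max_right ..).trans hn))
end
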